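/- arXiv:1606.02567 — 2 statements merged into one kernel-verified Lean document; each statement's English description precedes it below -/
import Mathlib

section
/- Let L be a graded nilpotent DGLA with H^0(L) = 0. Then the gauge group exp(L^0) acts freely on the set MC(L) of Maurer–Cartan elements; that is, if u ∈ exp(L^0) and x ∈ MC(L) satisfy u ∗ x = x, then u is the identity. -/
/-- A differential graded Lie algebra over `ℝ`: a graded vector space with a
degree-0 bracket and a degree-1 differential squaring to zero, satisfying
graded skew-symmetry, the graded Jacobi identity and the graded Leibniz rule. -/
structure DGLA (V : Type*) [AddCommGroup V] [Module ℝ V] where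
  grade : ℤ → Submodule ℝ V
  internal : DirectSum.IsInternal grade
  br : V →ₗ[ℝ] V →ₗ[ℝ] V
  br_grade : ∀ p q : ℤ, ∀ x ∈ grade p, ∀ y ∈ grade q, br x y ∈ grade (p + q)
  d : V →ₗ[ℝ] V
  d_grade : ∀ p : ℤ, ∀ x ∈ grade p, d x ∈ grade (p + 1)
  d_sq : ∀ x : V, d (d x) = 0
  skew : ∀ p q : ℤ, ∀ x ∈ grade p, ∀ y ∈ grade q,
    br x y = ((-1 : ℝ) ^ (p * q + 1).natAbs) • br y x
  jacobi : ∀ p q r : ℤ, ∀ x ∈ grade p, ∀ y ∈ grade q, ∀ z ∈ grade r,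
    ((-1 : ℝ) ^ (p * r).natAbs) • br x (br y z)
      + ((-1 : ℝ) ^ (q * p).natAbs) • br y (br z x)
      + ((-1 : ℝ) ^ (r * q).natAbs) • br z (br x y) = 0
  leibniz : ∀ p : ℤ, ∀ x ∈ grade p, ∀ y : V,
    d (br x y) = br (d x) y + ((-1 : ℝ) ^ p.natAbs) • br x (d y)

namespace DGLA

variable {V : Type*} [AddCommGroup V] [Module ℝ V]

/-- The Maurer–Cartan condition: `x ∈ L¹` and `dx + (1/2)[x,x] = 0`. -/
def IsMC (L : DGLA V) (x : V) : Prop :=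
  x ∈ L.grade 1 ∧ L.d x + (1 / 2 : ℝ) • L.br x x = 0

/-- The gauge action of `exp y` on `L¹`, obtained by exponentiating the affine
infinitesimal action `y ∗ x = [y,x] − dy`; since `ad y` is nilpotent (killed by
the `N`-th iterate), the exponential series is the displayed finite (polynomial)
sum: `e^y ∗ x = Σ (1/n!) (ad y)ⁿ x − Σ (1/(n+1)!) (ad y)ⁿ (dy)`. -/
noncomputable def gaugeExp (L : DGLA V) (N : ℕ) (y x : V) : V :=
  (∑ n ∈ Finset.range N, ((n.factorial : ℝ))⁻¹ • (fun w => L.br y w)^[n] x)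
    - ∑ n ∈ Finset.range N, (((n + 1).factorial : ℝ))⁻¹ • (fun w => L.br y w)^[n] (L.d y)

end DGLA

/-- A graded nilpotent DGLA: a finite-dimensional DGLA together with an
additional ("lower") grading in strictly positive degrees, compatible with the
bracket and the differential (both of lower-degree zero). -/
structure GradedNilDGLA (V : Type*) [AddCommGroup V] [Module ℝ V] extends DGLA V where
  lgrade : ℤ → Submodule ℝ V
  linternal : DirectSum.IsInternal lgrade
  lpos : ∀ i : ℤ, i ≤ 0 → lgrade i = ⊥
  br_lgrade : ∀ i j : ℤ, ∀ x ∈ lgrade i, ∀ y ∈ lgrade j, br x y ∈ lgrade (i + j)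
  d_lgrade : ∀ i : ℤ, ∀ x ∈ lgrade i, d x ∈ lgrade i

open scoped LinearAlgebra.Projectivization

/-- `1 + q + ⋯ + q ^ (n - 1) ≡ n` modulo any divisor of `q - 1`. -/
lemma card_projectivization_modEq {K V : Type*} [Field K] [Finite K] [AddCommGroup V] [Module K V]
    {l : ℕ} (hq : Nat.card K ≡ 1 [MOD l]) :
    Nat.card (ℙ K V) ≡ Module.finrank K V [MOD l] := by
  rw [Projectivization.card_of_finrank K V rfl]
  have h : ∀ n : ℕ, ∑ i ∈ Finset.range n, Nat.card K ^ i ≡ n [MOD l] := by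
    intro n
    induction n with
    | zero => rfl
    | succ n ih =>
      rw [Finset.sum_range_succ]
      simpa using ih.add (hq.pow n)
  exact h _

/-- A group of prime power order acting linearly in dimension smaller than the prime, over a finite
field whose multiplicative group has order divisible by the prime, acts through commuting maps. -/
lemma IsPGroup.smul_smul_comm_of_finrank_lt {G K V : Type*} [Group G] [Field K] [Finite K]
    [AddCommGroup V] [Module K V] [Module.Finite K V] [DistribMulAction G V] [SMulCommClass G K V]
    {l : ℕ} [Fact l.Prime] (hG : IsPGroup l G) (hq : Nat.card K ≡ 1 [MOD l])
    (hn : Module.finrank K V < l) (g h : G) (v : V) :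
    g • h • v = h • g • v := by
  classical
  let S : Set V := {v | ∀ g : G, ∃ c : K, g • v = c • v}
  let W : Submodule K V := Submodule.span K S
  have hS : ∀ (g : G), ∀ v ∈ W, g • v ∈ W := by
    intro g v hv
    induction hv using Submodule.span_induction with
    | mem v hv =>
      obtain ⟨c, hc⟩ := hv g
      rw [hc]
      exact W.smul_mem c (Submodule.subset_span hv)
    | zero => simp
    | add x y _ _ hx hy => rw [smul_add]; exact W.add_mem hx hy
    | smul a x _ hx => rw [smul_comm]; exact W.smul_mem a hx
  have hfin : Finite V := Module.finite_of_finite K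
  have hW : W = ⊤ := by
    by_contra hne
    have hlt : Module.finrank K W < Module.finrank K V := Submodule.finrank_lt hne
    let X : SubMulAction G (ℙ K V) :=
      { carrier := {x | x.rep ∉ W}
        smul_mem' := by
          intro g x hx hgx
          apply hx
          obtain ⟨a, ha⟩ := Projectivization.exists_smul_eq_mk_rep K (g • x.rep)
            ((smul_ne_zero_iff_ne g).mpr x.rep_nonzero)
          rw [← Projectivization.smul_mk g x.rep_nonzero, Projectivization.mk_rep] at ha
          rw [← ha, Units.smul_def] at hgx
          have h1 : g • x.rep ∈ W := (W.smul_mem_iff a.ne_zero).1 hgx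
          simpa using hS g⁻¹ _ h1 }
    let f : ℙ K W → ℙ K V := Projectivization.map W.subtype W.injective_subtype
    have hf : Function.Injective f := Projectivization.map_injective _ _
    have hr : Set.range f = (X : Set (ℙ K V))ᶜ := by
      ext x
      simp only [Set.mem_range, Set.mem_compl_iff]
      change _ ↔ ¬ (x.rep ∉ W)
      rw [not_not]
      constructor
      · rintro ⟨w, rfl⟩
        induction w using Projectivization.ind with
        | h w hw =>
          obtain ⟨a, ha⟩ := Projectivization.exists_smul_eq_mk_rep K (w : V) (by simpa using hw)
          change (Projectivization.mk K (w : V) _).rep ∈ W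
          rw [← ha]
          exact W.smul_mem _ w.2
      · intro hx
        refine ⟨Projectivization.mk K ⟨x.rep, hx⟩ (by simpa using x.rep_nonzero), ?_⟩
        exact x.mk_rep
    have hcard : Nat.card (ℙ K W) + Nat.card X = Nat.card (ℙ K V) := by
      rw [← Nat.card_range_of_injective hf, hr, add_comm]
      exact Set.ncard_add_ncard_compl (X : Set (ℙ K V))
    have hnd : ¬ l ∣ Nat.card X := by
      intro hd
      have h1 := card_projectivization_modEq (V := V) hq
      have h2 := card_projectivization_modEq (V := W) hq
      rw [← hcard] at h1
      have h3 := (h2.add (Nat.modEq_zero_iff_dvd.2 hd)).symm.trans h1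
      exact hlt.ne (Nat.ModEq.eq_of_lt_of_lt (by simpa using h3) (hlt.trans hn) hn)
    obtain ⟨⟨x, hxW⟩, hx⟩ := hG.nonempty_fixed_point_of_prime_not_dvd_card X hnd
    refine hxW (Submodule.subset_span fun g => ?_)
    have hgx : g • x = x := congrArg Subtype.val (hx g)
    rw [← x.mk_rep, Projectivization.smul_mk, Projectivization.mk_eq_mk_iff'] at hgx
    obtain ⟨a, ha⟩ := hgx
    exact ⟨a, ha.symm⟩
  have hv : v ∈ W := hW ▸ Submodule.mem_top
  induction hv using Submodule.span_induction with
  | mem v hv =>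
    obtain ⟨a, ha⟩ := hv g
    obtain ⟨b, hb⟩ := hv h
    rw [hb, smul_comm g b, ha, smul_comm h a, hb, smul_comm]
  | zero => simp
  | add x y _ _ hx hy => simp only [smul_add, hx, hy]
  | smul a x _ hx => rw [smul_comm h a, smul_comm g a, hx, smul_comm g a, smul_comm h a]

section GradedBasis

variable {ι K V : Type*} [Field K] [AddCommGroup V] [Module K V]

/-- The linear automorphism multiplying the basis vector `b i` by `z ^ deg i`. -/
noncomputable def gradedScaling (b : Module.Basis ι K V) (deg : ι → ℤ) (z : Kˣ) : V ≃ₗ[K] V :=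
  b.equiv (b.unitsSMul fun i => z ^ deg i) (Equiv.refl ι)

lemma gradedScaling_basis (b : Module.Basis ι K V) (deg : ι → ℤ) (z : Kˣ) (i : ι) :
    gradedScaling b deg z (b i) = z ^ deg i • b i := by
  simp [gradedScaling, Module.Basis.unitsSMul_apply]

lemma repr_gradedScaling (b : Module.Basis ι K V) (deg : ι → ℤ) (z : Kˣ) (v : V) (i : ι) :
    b.repr (gradedScaling b deg z v) i = (z ^ deg i : Kˣ) * b.repr v i := by
  classical
  have h : (b.coord i) ∘ₗ (gradedScaling b deg z).toLinearMap
      = ((z ^ deg i : Kˣ) : K) • b.coord i := by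
    refine b.ext fun j => ?_
    by_cases hij : j = i
    · subst hij
      simp [gradedScaling_basis, Units.smul_def]
    · simp [gradedScaling_basis, Units.smul_def, hij]
  simpa using LinearMap.congr_fun h v

lemma gradedScaling_of_homogeneous (b : Module.Basis ι K V) {deg : ι → ℤ} (z : Kˣ) {m : ℤ} {v : V}
    (hv : ∀ i, b.repr v i ≠ 0 → deg i = m) :
    gradedScaling b deg z v = z ^ m • v := by
  apply b.repr.injective
  ext i
  rw [repr_gradedScaling, Units.smul_def, map_smul, Finsupp.smul_apply, smul_eq_mul]
  by_cases h : b.repr v i = 0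
  · simp [h]
  · rw [hv i h]

lemma gradedScaling_pow (b : Module.Basis ι K V) (deg : ι → ℤ) {z : Kˣ} {n : ℕ} (hz : z ^ n = 1) :
    gradedScaling b deg z ^ n = 1 := by
  have h : ∀ (m : ℕ) (i : ι), (gradedScaling b deg z ^ m) (b i) = (z ^ deg i) ^ m • b i := by
    intro m i
    induction m with
    | zero => simp
    | succ m ih =>
      rw [pow_succ', LinearEquiv.mul_apply, ih, Units.smul_def, map_smul, gradedScaling_basis,
        Units.smul_def, Units.smul_def, smul_smul, pow_succ, Units.val_mul]
  refine b.ext' fun i => ?_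
  rw [h, ← zpow_natCast, ← zpow_mul, mul_comm, zpow_mul, zpow_natCast, hz]
  simp

/-- The bracket and the operator `d` are homogeneous of degrees `0` and `s` for the grading
in which the basis vector `b i` has degree `deg i`. -/
structure IsGradedBasis (b : Module.Basis ι K V) (deg : ι → ℤ) (s : ℤ)
    (br : V →ₗ[K] V →ₗ[K] V) (d : V →ₗ[K] V) : Prop where
  bracket : ∀ i j k, b.repr (br (b i) (b j)) k ≠ 0 → deg k = deg i + deg j
  differential : ∀ i k, b.repr (d (b i)) k ≠ 0 → deg k = deg i + s

/-- The linear automorphisms preserving a bracket and rescaling an operator. -/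
def rescalingAut (br : V →ₗ[K] V →ₗ[K] V) (d : V →ₗ[K] V) : Subgroup (V ≃ₗ[K] V) where
  carrier := {g | (∀ u v, g (br u v) = br (g u) (g v)) ∧ ∃ a : Kˣ, ∀ v, g (d v) = a • d (g v)}
  one_mem' := ⟨fun _ _ => rfl, 1, fun _ => (one_smul _ _).symm⟩
  mul_mem' := by
    rintro g h ⟨hg, a, ha⟩ ⟨hh, b, hb⟩
    refine ⟨fun u v => ?_, b * a, fun v => ?_⟩
    · simp only [LinearEquiv.mul_apply, hh, hg]
    · simp only [LinearEquiv.mul_apply, hb, Units.smul_def, map_smul, ha, smul_smul, Units.val_mul]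
  inv_mem' := by
    rintro g ⟨hg, a, ha⟩
    have hinv : ∀ v, g (g⁻¹ v) = v := fun v => g.apply_symm_apply v
    refine ⟨fun u v => ?_, a⁻¹, fun v => ?_⟩
    · apply g.injective
      rw [hg, hinv, hinv, hinv]
    · apply g.injective
      rw [hinv, Units.smul_def, map_smul, ha, hinv, ← Units.smul_def, inv_smul_smul]

lemma IsGradedBasis.gradedScaling_mem {b : Module.Basis ι K V} {deg : ι → ℤ} {s : ℤ}
    {br : V →ₗ[K] V →ₗ[K] V} {d : V →ₗ[K] V} (h : IsGradedBasis b deg s br d) (z : Kˣ) :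
    gradedScaling b deg z ∈ rescalingAut br d := by
  let g := (gradedScaling b deg z).toLinearMap
  constructor
  · have : br.compr₂ g = br.compl₁₂ g g := by
      refine b.ext fun i => b.ext fun j => ?_
      simp only [g, LinearMap.compr₂_apply, LinearMap.compl₁₂_apply, LinearEquiv.coe_coe,
        gradedScaling_basis, gradedScaling_of_homogeneous b z (h.bracket i j)]
      simp only [Units.smul_def, map_smul, LinearMap.smul_apply, smul_smul, zpow_add, Units.val_mul]
      rw [mul_comm]
    exact fun u v => LinearMap.congr_fun₂ this u v
  · refine ⟨z ^ s, fun v => ?_⟩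
    have : g ∘ₗ d = ((z ^ s : Kˣ) : K) • (d ∘ₗ g) := by
      refine b.ext fun i => ?_
      simp only [g, LinearMap.comp_apply, LinearEquiv.coe_coe, LinearMap.smul_apply,
        gradedScaling_basis, gradedScaling_of_homogeneous b z (h.differential i)]
      simp only [Units.smul_def, map_smul, smul_smul, zpow_add, Units.val_mul]
      rw [mul_comm]
    exact LinearMap.congr_fun this v

/-- If a linear map `m` preserves a positive grading and `d` is injective on the fixed vectors
of `m`, then no nonzero fixed vector `y` satisfies `d y = [y, x]`. -/
lemma IsGradedBasis.eq_zero_of_differential_eq_bracket [Finite ι] {b : Module.Basis ι K V}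
    {deg : ι → ℤ} {br : V →ₗ[K] V →ₗ[K] V} {d : V →ₗ[K] V} (h : IsGradedBasis b deg 0 br d)
    (hpos : ∀ i, 0 < deg i) {m : V →ₗ[K] V} (hm : ∀ i k, b.repr (m (b i)) k ≠ 0 → deg k = deg i)
    (hinj : ∀ v, m v = v → d v = 0 → v = 0) {x y : V} (hy : m y = y) (hxy : d y = br y x) :
    y = 0 := by
  classical
  have := Fintype.ofFinite ι
  by_contra hy0
  obtain ⟨i₁, hi₁⟩ : ∃ i, b.repr y i ≠ 0 := by
    by_contra! hc
    exact hy0 (b.repr.injective (by ext i; simpa using hc i))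
  obtain ⟨i₀, hi₀, hmin⟩ := (Finset.univ.filter fun i => b.repr y i ≠ 0).exists_min_image deg
    ⟨i₁, by simpa using hi₁⟩
  replace hi₀ : b.repr y i₀ ≠ 0 := by simpa using hi₀
  replace hmin : ∀ i, b.repr y i ≠ 0 → deg i₀ ≤ deg i := fun i hi => hmin i (by simpa using hi)
  let π : V →ₗ[K] V := b.constr K fun i => if deg i = deg i₀ then b i else 0
  have hπb : ∀ i, π (b i) = if deg i = deg i₀ then b i else 0 := fun i => b.constr_basis K _ i
  have hπ : ∀ v k, b.repr (π v) k = if deg k = deg i₀ then b.repr v k else 0 := by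
    intro v k
    have : b.coord k ∘ₗ π = (if deg k = deg i₀ then (1 : K) else 0) • b.coord k := by
      refine b.ext fun j => ?_
      by_cases hjk : j = k
      · subst hjk
        simp only [LinearMap.comp_apply, hπb]
        split_ifs <;> simp
      · simp only [LinearMap.comp_apply, hπb]
        split_ifs <;> simp [hjk]
    have := LinearMap.congr_fun this v
    simp only [LinearMap.comp_apply, LinearMap.smul_apply, Module.Basis.coord_apply,
      smul_eq_mul] at this
    rw [this]
    split_ifs <;> simp
  have hcomm : ∀ f : V →ₗ[K] V, (∀ i k, b.repr (f (b i)) k ≠ 0 → deg k = deg i) →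
      ∀ v, π (f v) = f (π v) := by
    intro f hf v
    have : π ∘ₗ f = f ∘ₗ π := by
      refine b.ext fun i => b.repr.injective ?_
      ext k
      simp only [LinearMap.comp_apply, hπ, hπb]
      by_cases hk : b.repr (f (b i)) k = 0
      · split_ifs <;> simp [hk]
      · rw [hf i k hk]
        split_ifs <;> simp
    exact LinearMap.congr_fun this v
  have hbr : π (br y x) = 0 := by
    rw [← b.sum_repr y, ← b.sum_repr x]
    simp only [map_sum, LinearMap.sum_apply, map_smul, LinearMap.smul_apply,
      Finset.smul_sum]
    refine Finset.sum_eq_zero fun j _ => Finset.sum_eq_zero fun i _ => ?_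
    by_cases hi : b.repr y i = 0 ∨ b.repr x j = 0
    · rcases hi with hi | hi <;> simp [hi]
    · push Not at hi
      have : π (br (b i) (b j)) = 0 := by
        apply b.repr.injective
        ext k
        rw [hπ]
        split_ifs with hk
        · by_contra hne
          have h1 := h.bracket i j k (by simpa using hne)
          have h2 := hmin i hi.1
          have h3 := hpos j
          omega
        · simp
      simp [this]
  have hz : π y = 0 := by
    apply hinj
    · rw [← hcomm m hm, hy]
    · rw [← hcomm d (by simpa using h.differential), hxy, hbr]
  apply hi₀
  simpa [hz] using (hπ y i₀).symm

end GradedBasis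

/-- Two elements of order dividing `l` in a finite group of linear automorphisms commute after
conjugating one of them, when the dimension is less than the prime `l`. -/
lemma exists_conj_commute {K V : Type*} [Field K] [Finite K] [AddCommGroup V] [Module K V]
    [Module.Finite K V] {l : ℕ} [Fact l.Prime] (hq : Nat.card K ≡ 1 [MOD l])
    (hn : Module.finrank K V < l) (G : Subgroup (V ≃ₗ[K] V)) {s t : V ≃ₗ[K] V}
    (hs : s ∈ G) (ht : t ∈ G) (hs1 : s ^ l = 1) (ht1 : t ^ l = 1) :
    ∃ g ∈ G, Commute (g * s * g⁻¹) t := by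
  have hfinV : Finite V := Module.finite_of_finite K
  have hfin : Finite (V ≃ₗ[K] V) := Finite.of_injective (fun g => (g : V → V)) DFunLike.coe_injective
  have hp : ∀ r : G, r ^ l = 1 → IsPGroup l (Subgroup.zpowers r) := by
    rintro r hr ⟨_, j, rfl⟩
    refine ⟨1, Subtype.ext ?_⟩
    change (r ^ j) ^ l ^ 1 = 1
    rw [pow_one, ← zpow_natCast, ← zpow_mul, mul_comm, zpow_mul, zpow_natCast, hr, one_zpow]
  obtain ⟨P, hP⟩ := (hp ⟨s, hs⟩ (Subtype.ext hs1)).exists_le_sylow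
  obtain ⟨Q, hQ⟩ := (hp ⟨t, ht⟩ (Subtype.ext ht1)).exists_le_sylow
  obtain ⟨g, hg⟩ := MulAction.exists_smul_eq G P Q
  refine ⟨g, g.2, ?_⟩
  have h1 : g * ⟨s, hs⟩ * g⁻¹ ∈ Q := by
    rw [← hg]
    exact Subgroup.smul_mem_pointwise_smul _ (MulAut.conj g) P.toSubgroup
      (hP (Subgroup.mem_zpowers _))
  have h2 : (⟨t, ht⟩ : G) ∈ Q := hQ (Subgroup.mem_zpowers _)
  ext v
  exact Q.2.smul_smul_comm_of_finrank_lt hq hn ⟨_, h1⟩ ⟨_, h2⟩ v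

lemma zpow_injOn_of_isPrimitiveRoot {M : Type*} [CommGroup M] {z : M} {l : ℕ}
    (hz : IsPrimitiveRoot z l) {m n : ℤ} (hmn : |m - n| < l) (h : z ^ m = z ^ n) : m = n := by
  have h1 : z ^ (m - n) = 1 := by rw [zpow_sub, h, mul_inv_cancel]
  have h2 := Int.eq_zero_of_abs_lt_dvd ((hz.zpow_eq_one_iff_dvd _).1 h1) hmn
  omega

/-- Over a finite field with enough roots of unity: if `d` and the bracket are homogeneous for a
grading where `d` has degree `1` and for a second, positive, grading where `d` has degree `0`, and
`d` is injective in degree `0` of the first grading, then `d y = [y, x]` forces `y = 0` for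
`y` of degree `0`. The two gradings need not be compatible: Sylow's theorem allows to
move one of them so that they become so. -/
lemma eq_zero_of_differential_eq_bracket_of_finite {ι κ K V : Type*} [Finite ι] [Finite κ]
    [Field K] [Finite K] [AddCommGroup V] [Module K V] {b : Module.Basis ι K V}
    {c : Module.Basis κ K V} {deg : ι → ℤ} {ldeg : κ → ℤ} {br : V →ₗ[K] V →ₗ[K] V}
    {d : V →ₗ[K] V} (hb : IsGradedBasis b deg 1 br d) (hc : IsGradedBasis c ldeg 0 br d)
    (hpos : ∀ j, 0 < ldeg j) {l : ℕ} [Fact l.Prime] {z : Kˣ} (hz : IsPrimitiveRoot z l)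
    (hn : Nat.card ι < l) (hdeg : ∀ i, |deg i| < l) (hldeg : ∀ j, ldeg j < l)
    (hinj : ∀ v, (∀ i, b.repr v i ≠ 0 → deg i = 0) → d v = 0 → v = 0)
    {x y : V} (hy : ∀ i, b.repr y i ≠ 0 → deg i = 0) (hxy : d y = br y x) :
    y = 0 := by
  have hfinV : Module.Finite K V := Module.Finite.of_basis b
  have hq : Nat.card K ≡ 1 [MOD l] := by
    have h1 : l ∣ Nat.card K - 1 := by
      rw [← Nat.card_units, hz.eq_orderOf]
      exact orderOf_dvd_natCard z
    exact ((Nat.modEq_iff_dvd' Nat.card_pos).2 h1).symm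
  set s := gradedScaling b deg z with hs
  set t := gradedScaling c ldeg z with ht
  have hfix : ∀ v, s v = v ↔ ∀ i, b.repr v i ≠ 0 → deg i = 0 := by
    intro v
    constructor
    · intro hv i hi
      have h1 := repr_gradedScaling b deg z v i
      rw [← hs, hv] at h1
      have h2 : z ^ deg i = z ^ (0 : ℤ) :=
        Units.ext (mul_right_cancel₀ hi (by simpa using h1.symm))
      exact zpow_injOn_of_isPrimitiveRoot hz (by simpa using hdeg i) h2
    · intro hv
      simpa using gradedScaling_of_homogeneous b z hv
  obtain ⟨g, hg, hcomm⟩ := exists_conj_commute hq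
    (by rwa [Module.finrank_eq_nat_card_basis b]) (rescalingAut br d)
    (hb.gradedScaling_mem z) (hc.gradedScaling_mem z)
    (gradedScaling_pow b deg hz.pow_eq_one) (gradedScaling_pow c ldeg hz.pow_eq_one)
  rw [← hs, ← ht] at hcomm
  obtain ⟨hgbr, a, hgd⟩ := hg
  have hinv : ∀ v, g (g⁻¹ v) = v := fun v => g.apply_symm_apply v
  have hinv' : ∀ v, g⁻¹ (g v) = v := fun v => g.symm_apply_apply v
  have hm : ∀ i k, c.repr ((g * s * g⁻¹) (c i)) k ≠ 0 → ldeg k = ldeg i := by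
    intro i k hk
    have h1 : (g * s * g⁻¹) (t (c i)) = t ((g * s * g⁻¹) (c i)) := LinearEquiv.congr_fun hcomm (c i)
    have h2 := congrArg (fun v => c.repr v k) h1
    simp only [ht, repr_gradedScaling, gradedScaling_basis] at h2
    rw [Units.smul_def, map_smul, map_smul, Finsupp.smul_apply, smul_eq_mul] at h2
    refine zpow_injOn_of_isPrimitiveRoot hz ?_ (Units.ext (mul_right_cancel₀ hk h2.symm))
    have h3 := hpos i
    have h4 := hpos k
    have h5 := hldeg i
    have h6 := hldeg k
    rw [abs_lt]
    omega
  have hgy : g y = 0 := by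
    refine hc.eq_zero_of_differential_eq_bracket hpos (m := (g * s * g⁻¹).toLinearMap) hm
      (fun v hv hdv => ?_) (x := (a⁻¹ : Kˣ) • g x) ?_ ?_
    · have h1 : s (g⁻¹ v) = g⁻¹ v := by
        apply g.injective
        rw [hinv]
        exact hv
      have h2 : d (g⁻¹ v) = 0 := by
        apply g.injective
        rw [hgd, hinv, hdv, smul_zero, map_zero]
      rw [← hinv v, hinj _ ((hfix _).1 h1) h2, map_zero]
    · change g (s (g⁻¹ (g y))) = g y
      rw [hinv', (hfix y).2 hy]
    · rw [Units.smul_def, map_smul, ← hgbr, ← hxy, hgd, ← Units.smul_def, inv_smul_smul]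
  simpa using hgy

lemma Int.isJacobsonRing : IsJacobsonRing ℤ := by
  rw [isJacobsonRing_iff_prime_eq]
  intro P hP
  by_cases hbot : P = ⊥
  · rw [hbot, eq_bot_iff]
    intro x hx
    have hu := Ideal.mem_jacobson_bot.1 hx x
    rw [Int.isUnit_iff] at hu
    rw [Ideal.mem_bot]
    rcases hu with hu | hu
    · simpa using hu
    · nlinarith [mul_self_nonneg x]
  · have := hP.isMaximal hbot
    exact Ideal.jacobson_eq_self_of_isMaximal

/-- A finitely generated commutative ring has a homomorphism to a finite field. -/
lemma exists_ringHom_finite_field (R : Type) [CommRing R] [Nontrivial R] [Algebra.FiniteType ℤ R] :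
    ∃ (K : Type) (_ : Field K) (_ : Finite K), Nonempty (R →+* K) := by
  obtain ⟨m, hm⟩ := Ideal.exists_maximal R
  let := Ideal.Quotient.field m
  have := Int.isJacobsonRing
  have hfin : Module.Finite ℤ (R ⧸ m) := finite_of_finite_type_of_isJacobsonRing ℤ (R ⧸ m)
  refine ⟨R ⧸ m, inferInstance, ?_, ⟨Ideal.Quotient.mk m⟩⟩
  obtain ⟨p, hp⟩ := CharP.exists (R ⧸ m)
  rcases CharP.char_is_prime_or_zero (R ⧸ m) p with hprime | rfl
  · have : Fact p.Prime := ⟨hprime⟩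
    let := ZMod.algebra (R ⧸ m) p
    have : IsScalarTower ℤ (ZMod p) (R ⧸ m) := inferInstance
    have : Module.Finite (ZMod p) (R ⧸ m) := Module.Finite.of_restrictScalars_finite ℤ _ _
    exact Module.finite_of_finite (ZMod p)
  · have : CharZero (R ⧸ m) := CharP.charP_to_charZero _
    have : Algebra.IsIntegral ℤ (R ⧸ m) := inferInstance
    have hfield : IsField ℤ := isField_of_isIntegral_of_isField
      (FaithfulSMul.algebraMap_injective ℤ (R ⧸ m)) (Field.toIsField _)
    exact absurd hfield Int.not_isField

/-- A finitely generated commutative ring has a homomorphism to a finite field containing a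
primitive `l`-th root of unity for some arbitrarily large prime `l`. -/
lemma exists_ringHom_finite_field_isPrimitiveRoot (R : Type) [CommRing R] [Nontrivial R]
    [Algebra.FiniteType ℤ R] (N : ℕ) :
    ∃ (K : Type) (_ : Field K) (_ : Finite K) (l : ℕ) (z : Kˣ), Nonempty (R →+* K) ∧
      l.Prime ∧ N < l ∧ IsPrimitiveRoot z l := by
  obtain ⟨k, _, _, ⟨φ⟩⟩ := exists_ringHom_finite_field R
  obtain ⟨p, hp⟩ := CharP.exists k
  obtain ⟨l, hl, hprime⟩ := Nat.exists_infinite_primes (N + p + 1)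
  have : NeZero (l : k) := ⟨fun h0 => by
    have hdvd := (CharP.cast_eq_zero_iff k p l).1 h0
    rcases (Nat.dvd_prime hprime).1 hdvd with h | h
    · exact CharP.char_ne_one k p h
    · omega⟩
  have : NeZero l := ⟨hprime.ne_zero⟩
  have hfin : Module.Finite k (CyclotomicField l k) :=
    IsCyclotomicExtension.finite_of_singleton l k _
  have hz := IsCyclotomicExtension.zeta_spec l k (CyclotomicField l k)
  refine ⟨CyclotomicField l k, inferInstance, Module.finite_of_finite k, l,
    (hz.isUnit hprime.ne_zero).unit, ⟨(algebraMap k _).comp φ⟩, hprime, by omega,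
    hz.isUnit_unit hprime.ne_zero⟩

/-- Coordinates, over a commutative ring, of an algebra with bracket structure constants `B` and
operator matrix `D`, homogeneous for the grading `deg` of the standard basis and for the grading
`ldeg` of a second basis, whose transition matrices are `A` and `A'`; the matrix `S` is a left
inverse of the operator in degree `0`, and `y` is a degree `0` solution of `d y = [y, x]` with
invertible coordinate `y i₀`. -/
structure BigradedCoordinates {ι κ R : Type*} [Fintype ι] [Fintype κ] [DecidableEq ι]
    [DecidableEq κ] [CommRing R] (deg : ι → ℤ) (ldeg : κ → ℤ) (B : ι → ι → ι → R) (D : ι → ι → R)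
    (A : κ → ι → R) (A' : ι → κ → R) (S : ι → ι → R) (x y : ι → R) (i₀ : ι) (u : R) : Prop where
  bracket_deg : ∀ i j k, deg k ≠ deg i + deg j → B i j k = 0
  differential_deg : ∀ i k, deg k ≠ deg i + 1 → D i k = 0
  transition_mul : ∀ j k, ∑ i, A j i * A' i k = if j = k then 1 else 0
  transition_mul' : ∀ i k, ∑ j, A' i j * A j k = if i = k then 1 else 0
  bracket_ldeg : ∀ i j k, ldeg k ≠ ldeg i + ldeg j →
    ∑ m, (∑ a, ∑ b, A i a * A j b * B a b m) * A' m k = 0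
  differential_ldeg : ∀ i k, ldeg k ≠ ldeg i → ∑ m, (∑ a, A i a * D a m) * A' m k = 0
  left_inverse : ∀ i k, deg i = 0 → ∑ m, D i m * S m k = if i = k then 1 else 0
  deg_eq_zero : ∀ i, deg i ≠ 0 → y i = 0
  differential_eq_bracket : ∀ k, ∑ i, y i * D i k = ∑ i, ∑ j, y i * x j * B i j k
  mul_eq_one : y i₀ * u = 1

namespace BigradedCoordinates

variable {ι κ : Type*} [Fintype ι] [Fintype κ] [DecidableEq ι] [DecidableEq κ]
  {deg : ι → ℤ} {ldeg : κ → ℤ}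

section CommRing

variable {R T : Type*} [CommRing R] [CommRing T] {B : ι → ι → ι → R} {D : ι → ι → R}
  {A : κ → ι → R} {A' : ι → κ → R} {S : ι → ι → R} {x y : ι → R} {i₀ : ι} {u : R}

lemma map (h : BigradedCoordinates deg ldeg B D A A' S x y i₀ u) (f : R →+* T) :
    BigradedCoordinates deg ldeg (fun i j k => f (B i j k)) (fun i j => f (D i j))
      (fun i j => f (A i j)) (fun i j => f (A' i j)) (fun i j => f (S i j)) (fun i => f (x i))
      (fun i => f (y i)) i₀ (f u) where
  bracket_deg i j k hk := by simp [h.bracket_deg i j k hk]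
  differential_deg i k hk := by simp [h.differential_deg i k hk]
  transition_mul j k := by simpa [apply_ite f] using congrArg f (h.transition_mul j k)
  transition_mul' i k := by simpa [apply_ite f] using congrArg f (h.transition_mul' i k)
  bracket_ldeg i j k hk := by simpa using congrArg f (h.bracket_ldeg i j k hk)
  differential_ldeg i k hk := by simpa using congrArg f (h.differential_ldeg i k hk)
  left_inverse i k hi := by simpa [apply_ite f] using congrArg f (h.left_inverse i k hi)
  deg_eq_zero i hi := by simp [h.deg_eq_zero i hi]
  differential_eq_bracket k := by simpa using congrArg f (h.differential_eq_bracket k)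
  mul_eq_one := by simpa using congrArg f h.mul_eq_one

lemma of_map {f : R →+* T} (hf : Function.Injective f)
    (h : BigradedCoordinates deg ldeg (fun i j k => f (B i j k)) (fun i j => f (D i j))
      (fun i j => f (A i j)) (fun i j => f (A' i j)) (fun i j => f (S i j)) (fun i => f (x i))
      (fun i => f (y i)) i₀ (f u)) :
    BigradedCoordinates deg ldeg B D A A' S x y i₀ u where
  bracket_deg i j k hk := hf (by simpa using h.bracket_deg i j k hk)
  differential_deg i k hk := hf (by simpa using h.differential_deg i k hk)
  transition_mul j k := hf (by simpa [apply_ite f] using h.transition_mul j k)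
  transition_mul' i k := hf (by simpa [apply_ite f] using h.transition_mul' i k)
  bracket_ldeg i j k hk := hf (by simpa using h.bracket_ldeg i j k hk)
  differential_ldeg i k hk := hf (by simpa using h.differential_ldeg i k hk)
  left_inverse i k hi := hf (by simpa [apply_ite f] using h.left_inverse i k hi)
  deg_eq_zero i hi := hf (by simpa using h.deg_eq_zero i hi)
  differential_eq_bracket k := hf (by simpa using h.differential_eq_bracket k)
  mul_eq_one := hf (by simpa using h.mul_eq_one)

end CommRing

lemma false_of_finite {K : Type*} [Field K] [Finite K] {B : ι → ι → ι → K} {D : ι → ι → K}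
    {A : κ → ι → K} {A' : ι → κ → K} {S : ι → ι → K} {x y : ι → K} {i₀ : ι} {u : K}
    (h : BigradedCoordinates deg ldeg B D A A' S x y i₀ u) (hpos : ∀ j, 0 < ldeg j) {l : ℕ}
    (hl : l.Prime) {z : Kˣ} (hz : IsPrimitiveRoot z l) (hn : Nat.card ι < l)
    (hdeg : ∀ i, |deg i| < l) (hldeg : ∀ j, ldeg j < l) : False := by
  have : Fact l.Prime := ⟨hl⟩
  let d : (ι → K) →ₗ[K] (ι → K) := Matrix.vecMulLinear (Matrix.of D)
  have hd : ∀ v k, d v k = ∑ i, v i * D i k := fun _ _ => rfl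
  let br : (ι → K) →ₗ[K] (ι → K) →ₗ[K] (ι → K) :=
    LinearMap.mk₂ K (fun v w k => ∑ i, ∑ j, v i * w j * B i j k)
      (fun v v' w => by ext k; simp [add_mul, Finset.sum_add_distrib])
      (fun a v w => by ext k; simp [Finset.mul_sum, mul_assoc])
      (fun v w w' => by ext k; simp [mul_add, add_mul, Finset.sum_add_distrib])
      (fun a v w => by ext k; simp [Finset.mul_sum, mul_assoc, mul_left_comm])
  have hbr : ∀ v w k, br v w k = ∑ i, ∑ j, v i * w j * B i j k := fun _ _ _ => rfl
  have hAA' : Matrix.of A * Matrix.of A' = 1 := by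
    ext j k
    simpa [Matrix.mul_apply, Matrix.one_apply] using h.transition_mul j k
  have hA'A : Matrix.of A' * Matrix.of A = 1 := by
    ext j k
    simpa [Matrix.mul_apply, Matrix.one_apply] using h.transition_mul' j k
  let e : (ι → K) ≃ₗ[K] (κ → K) := LinearEquiv.ofLinearMap (Matrix.vecMulLinear (Matrix.of A'))
    (Matrix.vecMulLinear (Matrix.of A))
    (by refine LinearMap.ext fun v => ?_; simp [Matrix.vecMul_vecMul, hAA'])
    (by refine LinearMap.ext fun v => ?_; simp [Matrix.vecMul_vecMul, hA'A])
  let b := Pi.basisFun K ι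
  let c := Module.Basis.ofEquivFun e
  have hc : ∀ j, c j = A j := by
    intro j
    have h1 : c j = Matrix.vecMul (Pi.single j 1) (Matrix.of A) := by
      rw [Module.Basis.coe_ofEquivFun]
      rfl
    rw [h1, Matrix.single_one_vecMul]
    rfl
  have hcr : ∀ v j, c.repr v j = ∑ m, v m * A' m j := fun v j => by
    rw [← Module.Basis.equivFun_apply, Module.Basis.equivFun_ofEquivFun]
    rfl
  have hb1 : ∀ i j k, br (b i) (b j) k = B i j k := by
    intro i j k
    simp [hbr, b, Pi.single_apply]
  have hb2 : ∀ i k, d (b i) k = D i k := by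
    intro i k
    simp [hd, b, Pi.single_apply]
  have hbg : IsGradedBasis b deg 1 br d :=
    ⟨fun i j k hk => by_contra fun hne => hk ((hb1 i j k).trans (h.bracket_deg i j k hne)),
      fun i k hk => by_contra fun hne => hk ((hb2 i k).trans (h.differential_deg i k hne))⟩
  have hcg : IsGradedBasis c ldeg 0 br d := by
    constructor
    · intro i j k hk
      by_contra hne
      apply hk
      rw [hcr, ← h.bracket_ldeg i j k hne]
      simp only [hbr, hc]
    · intro i k hk
      rw [add_zero]
      by_contra hne
      apply hk
      rw [hcr, ← h.differential_ldeg i k hne]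
      simp only [hd, hc]
  have hy : y = 0 := by
    refine eq_zero_of_differential_eq_bracket_of_finite hbg hcg hpos hz hn hdeg hldeg
      (fun v hv hdv => ?_) (x := x) (fun i hi => ?_) ?_
    · ext k
      have h1 : ∑ m, d v m * S m k = v k := by
        simp only [hd, Finset.sum_mul]
        rw [Finset.sum_comm]
        calc ∑ i, ∑ m, v i * D i m * S m k = ∑ i, v i * (if i = k then 1 else 0) := by
              refine Finset.sum_congr rfl fun i _ => ?_
              simp only [mul_assoc, ← Finset.mul_sum]
              by_cases hi : v i = 0
              · simp [hi]
              · rw [h.left_inverse i k (hv i hi)]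
          _ = v k := by simp
      rw [← h1, hdv]
      simp
    · exact by_contra fun hne => hi (h.deg_eq_zero i hne)
    · ext k
      rw [hd, hbr]
      exact h.differential_eq_bracket k
  have h1 := h.mul_eq_one
  rw [hy] at h1
  simp at h1

lemma false_of_real {B : ι → ι → ι → ℝ} {D : ι → ι → ℝ} {A : κ → ι → ℝ} {A' : ι → κ → ℝ}
    {S : ι → ι → ℝ} {x y : ι → ℝ} {i₀ : ι} {u : ℝ}
    (h : BigradedCoordinates deg ldeg B D A A' S x y i₀ u) (hpos : ∀ j, 0 < ldeg j) : False := by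
  let s : Set ℝ := (Set.range fun p : ι × ι × ι => B p.1 p.2.1 p.2.2) ∪
    (Set.range fun p : ι × ι => D p.1 p.2) ∪ (Set.range fun p : κ × ι => A p.1 p.2) ∪
    (Set.range fun p : ι × κ => A' p.1 p.2) ∪ (Set.range fun p : ι × ι => S p.1 p.2) ∪
    Set.range x ∪ Set.range y ∪ {u}
  have hs : s.Finite := by
    simp only [s, Set.finite_union, Set.finite_singleton, Set.finite_range, and_self]
  let R := Algebra.adjoin ℤ s
  have hB : ∀ i j k, B i j k ∈ R := fun i j k => Algebra.subset_adjoin (by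
    have := Set.mem_range_self (f := fun p : ι × ι × ι => B p.1 p.2.1 p.2.2) (i, j, k)
    simp only [s, Set.mem_union]
    tauto)
  have hD : ∀ i j, D i j ∈ R := fun i j => Algebra.subset_adjoin (by
    have := Set.mem_range_self (f := fun p : ι × ι => D p.1 p.2) (i, j)
    simp only [s, Set.mem_union]
    tauto)
  have hA : ∀ i j, A i j ∈ R := fun i j => Algebra.subset_adjoin (by
    have := Set.mem_range_self (f := fun p : κ × ι => A p.1 p.2) (i, j)
    simp only [s, Set.mem_union]
    tauto)
  have hA' : ∀ i j, A' i j ∈ R := fun i j => Algebra.subset_adjoin (by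
    have := Set.mem_range_self (f := fun p : ι × κ => A' p.1 p.2) (i, j)
    simp only [s, Set.mem_union]
    tauto)
  have hS : ∀ i j, S i j ∈ R := fun i j => Algebra.subset_adjoin (by
    have := Set.mem_range_self (f := fun p : ι × ι => S p.1 p.2) (i, j)
    simp only [s, Set.mem_union]
    tauto)
  have hx : ∀ i, x i ∈ R := fun i => Algebra.subset_adjoin (by
    have := Set.mem_range_self (f := x) i
    simp only [s, Set.mem_union]
    tauto)
  have hy : ∀ i, y i ∈ R := fun i => Algebra.subset_adjoin (by
    have := Set.mem_range_self (f := y) i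
    simp only [s, Set.mem_union]
    tauto)
  have hu : u ∈ R := Algebra.subset_adjoin (Or.inr rfl)
  have hR : BigradedCoordinates deg ldeg (R := R) (fun i j k => ⟨B i j k, hB i j k⟩)
      (fun i j => ⟨D i j, hD i j⟩) (fun i j => ⟨A i j, hA i j⟩) (fun i j => ⟨A' i j, hA' i j⟩)
      (fun i j => ⟨S i j, hS i j⟩) (fun i => ⟨x i, hx i⟩) (fun i => ⟨y i, hy i⟩) i₀ ⟨u, hu⟩ :=
    of_map (f := R.val.toRingHom) Subtype.val_injective h
  have hfg : Algebra.FiniteType ℤ R := .adjoin_of_finite hs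
  obtain ⟨K, _, _, l, z, ⟨φ⟩, hl, hN, hz⟩ := exists_ringHom_finite_field_isPrimitiveRoot R
    (Nat.card ι + ∑ i, (deg i).natAbs + ∑ j, (ldeg j).natAbs)
  refine (hR.map φ).false_of_finite hpos hl hz (by omega) (fun i => ?_) (fun j => ?_)
  · have := Finset.single_le_sum (f := fun i => (deg i).natAbs) (fun _ _ => Nat.zero_le _)
      (Finset.mem_univ i)
    rw [Int.abs_eq_natAbs]
    omega
  · have := Finset.single_le_sum (f := fun j => (ldeg j).natAbs) (fun _ _ => Nat.zero_le _)
      (Finset.mem_univ j)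
    omega

end BigradedCoordinates

lemma Module.Basis.repr_linearMap_apply {ι κ F V W : Type*} [Fintype ι] [Field F] [AddCommGroup V]
    [Module F V] [AddCommGroup W] [Module F W] (b : Module.Basis ι F V) (c : Module.Basis κ F W)
    (f : V →ₗ[F] W) (v : V) (k : κ) :
    c.repr (f v) k = ∑ i, b.repr v i * c.repr (f (b i)) k := by
  conv_lhs => rw [← b.sum_repr v]
  simp only [map_sum, map_smul, Finsupp.coe_finsetSum, Finset.sum_apply, Finsupp.smul_apply,
    smul_eq_mul]

/-- A basis of a finite-dimensional graded space adapted to the grading. -/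
lemma DirectSum.IsInternal.exists_homogeneous_basis {F V : Type*} [Field F] [AddCommGroup V]
    [Module F V] [FiniteDimensional F V] {A : ℤ → Submodule F V} (hA : DirectSum.IsInternal A) :
    ∃ (n : ℕ) (b : Module.Basis (Fin n) F V) (deg : Fin n → ℤ), (∀ i, b i ∈ A (deg i)) ∧
      ∀ p, ∀ v, v ∈ A p ↔ ∀ i, b.repr v i ≠ 0 → deg i = p := by
  classical
  let c := hA.collectedBasis fun i => Module.finBasis F (A i)
  have hfin : Finite (Σ i, Fin (Module.finrank F (A i))) := Module.Finite.finite_basis c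
  obtain ⟨n, ⟨e⟩⟩ := Finite.exists_equiv_fin (Σ i, Fin (Module.finrank F (A i)))
  have hmem : ∀ i, c.reindex e i ∈ A (e.symm i).1 := fun i => by
    rw [Module.Basis.reindex_apply]
    exact hA.collectedBasis_mem _ _
  refine ⟨n, c.reindex e, fun i => (e.symm i).1, hmem, fun p v => ⟨fun hv i hi => ?_, fun hv => ?_⟩⟩
  · by_contra hne
    apply hi
    rw [Module.Basis.repr_reindex_apply]
    exact hA.collectedBasis_repr_of_mem_ne _ (Ne.symm hne) hv
  · rw [← (c.reindex e).sum_repr v]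
    refine Submodule.sum_mem _ fun i _ => ?_
    by_cases hi : (c.reindex e).repr v i = 0
    · rw [hi, zero_smul]
      exact Submodule.zero_mem _
    · exact Submodule.smul_mem _ _ (hv i hi ▸ hmem i)

namespace GradedNilDGLA

variable {V : Type*} [AddCommGroup V] [Module ℝ V] [FiniteDimensional ℝ V]

/-- If `d` is injective on `L⁰`, the infinitesimal gauge action is free. -/
lemma eq_zero_of_d_eq_br (L : GradedNilDGLA V) (hH0 : ∀ y ∈ L.grade 0, L.d y = 0 → y = 0)
    {x y : V} (hy : y ∈ L.grade 0) (hxy : L.d y = L.br y x) : y = 0 := by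
  classical
  obtain ⟨m, b, deg, hb, hbm⟩ := L.internal.exists_homogeneous_basis
  obtain ⟨n, c, ldeg, hc, hcm⟩ := L.linternal.exists_homogeneous_basis
  have hpos : ∀ j, 0 < ldeg j := by
    intro j
    by_contra hj
    have h1 := hc j
    rw [L.lpos _ (not_lt.1 hj), Submodule.mem_bot] at h1
    exact c.ne_zero j h1
  obtain ⟨s, hs⟩ := (L.d ∘ₗ (L.grade 0).subtype).exists_leftInverse_of_injective
    (LinearMap.ker_eq_bot'.2 fun v hv => Subtype.ext (hH0 v v.2 hv))
  have hs' : ∀ v ∈ L.grade 0, (s (L.d v) : V) = v := fun v hv =>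
    congrArg Subtype.val (LinearMap.congr_fun hs ⟨v, hv⟩)
  by_contra hy0
  obtain ⟨i₀, hi₀⟩ : ∃ i, b.repr y i ≠ 0 := by
    by_contra! hne
    exact hy0 (b.repr.injective (by ext i; simpa using hne i))
  have hbr : ∀ {κ : Type} (e : Module.Basis κ ℝ V) (v w : V) (k : κ), e.repr (L.br v w) k =
      ∑ i, ∑ j, b.repr v i * b.repr w j * e.repr (L.br (b i) (b j)) k := by
    intro κ e v w k
    rw [← LinearMap.flip_apply, b.repr_linearMap_apply e]
    refine Finset.sum_congr rfl fun i _ => ?_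
    rw [LinearMap.flip_apply, b.repr_linearMap_apply e, Finset.mul_sum]
    exact Finset.sum_congr rfl fun j _ => (mul_assoc _ _ _).symm
  have hcoord : ∀ v k, ∑ i, b.repr v i * c.repr (b i) k = c.repr v k := fun v k =>
    (b.repr_linearMap_apply c LinearMap.id v k).symm
  have hmodel : BigradedCoordinates deg ldeg (fun i j k => b.repr (L.br (b i) (b j)) k)
      (fun i k => b.repr (L.d (b i)) k) (fun j i => b.repr (c j) i) (fun i j => c.repr (b i) j)
      (fun i k => b.repr (s (b i) : V) k) (b.repr x) (b.repr y) i₀ (b.repr y i₀)⁻¹ :=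
    { bracket_deg := fun i j k hk => by_contra fun hne =>
        hk ((hbm _ _).1 (L.br_grade _ _ _ (hb i) _ (hb j)) k hne)
      differential_deg := fun i k hk => by_contra fun hne =>
        hk ((hbm _ _).1 (L.d_grade _ _ (hb i)) k hne)
      transition_mul := fun j k => by
        rw [hcoord, c.repr_self_apply]
      transition_mul' := fun i k => by
        rw [← b.repr_self_apply]
        exact (c.repr_linearMap_apply b LinearMap.id (b i) k).symm
      bracket_ldeg := fun i j k hk => by
        simp only [← hbr b, hcoord]
        exact by_contra fun hne => hk ((hcm _ _).1 (L.br_lgrade _ _ _ (hc i) _ (hc j)) k hne)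
      differential_ldeg := fun i k hk => by
        simp only [← b.repr_linearMap_apply b L.d, hcoord]
        exact by_contra fun hne => hk ((hcm _ _).1 (L.d_lgrade _ _ (hc i)) k hne)
      left_inverse := fun i k hi => by
        have h1 := b.repr_linearMap_apply b ((L.grade 0).subtype ∘ₗ s) (L.d (b i)) k
        simp only [LinearMap.comp_apply, Submodule.subtype_apply] at h1
        rw [← h1, hs' _ (hi ▸ hb i), b.repr_self_apply]
      deg_eq_zero := fun i hi => by_contra fun hne => hi ((hbm _ _).1 hy i hne)
      differential_eq_bracket := fun k => by
        rw [← b.repr_linearMap_apply b L.d, hxy, hbr b]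
      mul_eq_one := mul_inv_cancel₀ hi₀ }
  exact hmodel.false_of_real hpos

end GradedNilDGLA

/-- For a nilpotent operator `T`, the unipotent operator `∑ Tⁿ / (n + 1)!` is injective. -/
lemma eq_zero_of_sum_factorial_smul_pow_eq_zero {V : Type*} [AddCommGroup V] [Module ℝ V]
    {T : V →ₗ[ℝ] V} (hT : IsNilpotent T) {N : ℕ} (hN : N ≠ 0) {w : V}
    (hw : ∑ n ∈ Finset.range N, ((n + 1).factorial : ℝ)⁻¹ • (T ^ n) w = 0) : w = 0 := by
  obtain ⟨M, rfl⟩ := Nat.exists_eq_succ_of_ne_zero hN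
  by_contra hw0
  obtain ⟨r, hr⟩ := hT
  have hex : ∃ k, (T ^ k) w = 0 := ⟨r, by simp [hr]⟩
  classical
  have hk := Nat.find_spec hex
  have hmin : ∀ j < Nat.find hex, (T ^ j) w ≠ 0 := fun j hj => Nat.find_min hex hj
  obtain ⟨k, hk'⟩ : ∃ k, Nat.find hex = k + 1 := Nat.exists_eq_succ_of_ne_zero fun h0 => by
    rw [h0] at hk
    exact hw0 (by simpa using hk)
  rw [hk'] at hk hmin
  apply hmin k (Nat.lt_succ_self k)
  have h1 := congrArg (T ^ k) hw
  rw [map_sum, Finset.sum_range_succ', Finset.sum_eq_zero, map_zero] at h1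
  · simpa using h1
  · intro n _
    rw [map_smul, ← Module.End.mul_apply, ← pow_add, show k + (n + 1) = n + (k + 1) by omega,
      pow_add, Module.End.mul_apply, hk, map_zero, smul_zero]

/-- An element fixed by the gauge action of `exp y` is fixed infinitesimally. -/
lemma DGLA.d_eq_br_of_gaugeExp_eq {V : Type*} [AddCommGroup V] [Module ℝ V] (L : DGLA V)
    {x y : V} {N : ℕ} (hN : ∀ v : V, (fun w => L.br y w)^[N] v = 0)
    (hfix : L.gaugeExp N y x = x) : L.d y = L.br y x := by
  set T : V →ₗ[ℝ] V := L.br y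
  have hiter : ∀ (n : ℕ) (v : V), (fun w => L.br y w)^[n] v = (T ^ n) v := fun n v =>
    (Module.End.pow_apply T n v).symm
  have hTN : ∀ v, (T ^ N) v = 0 := fun v => (hiter N v).symm.trans (hN v)
  rcases Nat.eq_zero_or_pos N with rfl | hpos
  · have h0 : ∀ v : V, v = 0 := fun v => by simpa using hTN v
    rw [h0 (L.d y), h0 (T x)]
  obtain ⟨M, rfl⟩ := Nat.exists_eq_succ_of_ne_zero hpos.ne'
  rw [eq_comm, ← sub_eq_zero]
  refine eq_zero_of_sum_factorial_smul_pow_eq_zero (T := T) ⟨M + 1, LinearMap.ext hTN⟩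
    (Nat.succ_ne_zero M) ?_
  unfold DGLA.gaugeExp at hfix
  simp only [hiter] at hfix
  rw [Finset.sum_range_succ'] at hfix
  simp only [map_sub, smul_sub, Finset.sum_sub_distrib]
  have h1 : ∑ n ∈ Finset.range (M + 1), ((n + 1).factorial : ℝ)⁻¹ • (T ^ n) (T x)
      = ∑ n ∈ Finset.range M, ((n + 1).factorial : ℝ)⁻¹ • (T ^ (n + 1)) x := by
    rw [Finset.sum_range_succ, ← Module.End.mul_apply, ← pow_succ, hTN, smul_zero, add_zero]
    simp only [pow_succ, Module.End.mul_apply]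
  rw [h1]
  have h2 : ((Nat.factorial 0 : ℕ) : ℝ)⁻¹ • (T ^ 0) x = x := by simp
  rw [h2, add_sub_right_comm] at hfix
  simpa using hfix

/-- in a graded nilpotent DGLA with `H⁰(L) = 0` (i.e. `d` is
injective on `L⁰`), the gauge group `exp L⁰` acts freely on the set of
Maurer–Cartan elements: if `y ∈ L⁰` fixes a Maurer–Cartan element `x` under
the gauge action (the polynomial exponential of `y ∗ x = [y,x] − dy`),
then `exp y` is the identity, i.e. `y = 0`. -/
theorem gauge_action_free {V : Type*} [AddCommGroup V] [Module ℝ V] [FiniteDimensional ℝ V]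
    (L : GradedNilDGLA V)
    (hH0 : ∀ y ∈ L.grade 0, L.d y = 0 → y = 0)
    (x y : V) (hx : L.toDGLA.IsMC x) (hy : y ∈ L.grade 0)
    (N : ℕ) (hN : ∀ v : V, (fun w => L.br y w)^[N] v = 0)
    (hfix : L.toDGLA.gaugeExp N y x = x) :
    y = 0 := by
  exact L.eq_zero_of_d_eq_br hH0 hy (L.toDGLA.d_eq_br_of_gaugeExp_eq hN hfix)
end

section
/- Let sl(2,ℝ) have standard basis H, X, Y with [H,X] = 2X, [H,Y] = −2Y, [X,Y] = H, and let W be the 6-dimensional irreducible sl(2,ℝ)-representation of quintic binary forms in variables z, w, with weight vectors v_j = z^{5−j}w^j having H-weight 5 − 2j. Then up to the action of GL(2,ℝ), every nonzero element of W whose stabilizer in sl(2,ℝ) ⊕ ℝ² (acting through sl(2,ℝ) and scalars) is at least two-dimensional is conjugate to exactly one of z^5, z^4 w, or z^3 w^2. -/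
open MvPolynomial

/-- The natural action of a 2×2 matrix `M` on binary forms by the derivation
`D_M = Σ_{i,j} M_{ij} · z_i ∂/∂z_j`; for `H = diag(1,−1)`, `X = E₀₁`, `Y = E₁₀`
this realises the standard `sl(2,ℝ)`-basis `z∂_z − w∂_w`, `z∂_w`, `w∂_z` with
`[H,X] = 2X`, `[H,Y] = −2Y`, `[X,Y] = H`. -/
noncomputable def matDeriv (M : Matrix (Fin 2) (Fin 2) ℝ)
    (q : MvPolynomial (Fin 2) ℝ) : MvPolynomial (Fin 2) ℝ :=
  ∑ i : Fin 2, ∑ j : Fin 2, C (M i j) * (X i * pderiv j q)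

/-- The linear substitution action of a matrix on binary forms. -/
noncomputable def matSubst (g : Matrix (Fin 2) (Fin 2) ℝ)
    (q : MvPolynomial (Fin 2) ℝ) : MvPolynomial (Fin 2) ℝ :=
  aeval (fun i : Fin 2 => ∑ j : Fin 2, C (g i j) * X j) q

/-- The stabiliser of a quintic `q` inside `sl(2,ℝ) ⊕ ℝ²`, where the abelian
factor `ℝ²` acts on `q` by scalars through the fixed weight `μ`. -/
def quinticStab (μ : (ℝ × ℝ) →ₗ[ℝ] ℝ) (q : MvPolynomial (Fin 2) ℝ) :
    Set (Matrix (Fin 2) (Fin 2) ℝ × (ℝ × ℝ)) :=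
  {P | P.1.trace = 0 ∧ matDeriv P.1 q + μ P.2 • q = 0}

theorem matSubst_mul (g h : Matrix (Fin 2) (Fin 2) ℝ) (q : MvPolynomial (Fin 2) ℝ) :
    matSubst (g * h) q = matSubst h (matSubst g q) := by
  unfold matSubst
  rw [← AlgHom.comp_apply]
  refine DFunLike.congr_fun (MvPolynomial.algHom_ext fun i => ?_) q
  simp only [Matrix.mul_apply, Fin.sum_univ_two, AlgHom.comp_apply, aeval_X, aeval_C,
    algebraMap_eq, map_add, map_mul]
  ring

theorem matSubst_one (q : MvPolynomial (Fin 2) ℝ) : matSubst 1 q = q := by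
  unfold matSubst
  conv_rhs => rw [← aeval_X_left_apply (R := ℝ) q]
  congr 2
  funext i
  simp [Matrix.one_apply]

theorem matSubst_inv_eq {g : GL (Fin 2) ℝ} {p q : MvPolynomial (Fin 2) ℝ}
    (h : matSubst g q = p) : matSubst (g⁻¹ : GL (Fin 2) ℝ) p = q := by
  rw [← h, ← matSubst_mul, ← Units.val_mul, mul_inv_cancel, Units.val_one, matSubst_one]

theorem isHomogeneous_matSubst {q : MvPolynomial (Fin 2) ℝ} {n : ℕ} (hq : q.IsHomogeneous n)
    (g : Matrix (Fin 2) (Fin 2) ℝ) : (matSubst g q).IsHomogeneous n := by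
  have := hq.aeval (n := 1) (fun i : Fin 2 => ∑ j : Fin 2, C (g i j) * X j) fun i =>
    IsHomogeneous.sum _ _ _ fun j _ => isHomogeneous_C_mul_X _ _
  simpa [matSubst] using this

/-- Chain rule: a linear substitution intertwines the derivations attached to similar matrices. -/
theorem matSubst_matDeriv {g M M' : Matrix (Fin 2) (Fin 2) ℝ}
    (h : g * M'.transpose = M.transpose * g) (q : MvPolynomial (Fin 2) ℝ) :
    matSubst g (matDeriv M q) = matDeriv M' (matSubst g q) := by
  have entry (i j : Fin 2) : g i 0 * M' j 0 + g i 1 * M' j 1 = M 0 i * g 0 j + M 1 i * g 1 j := by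
    simpa [Matrix.mul_apply, Fin.sum_univ_two] using congrFun (congrFun h i) j
  have entryC (i j : Fin 2) := congrArg (C : ℝ → MvPolynomial (Fin 2) ℝ) (entry i j)
  simp only [map_add, map_mul] at entryC
  unfold matDeriv matSubst
  induction q using MvPolynomial.induction_on with
  | C a => simp
  | add p q hp hq =>
    simp only [map_add, mul_add, Finset.sum_add_distrib] at hp hq ⊢
    rw [hp, hq]
  | mul_X p i hp =>
    have e0 := entryC i 0
    have e1 := entryC i 1
    simp only [Fin.sum_univ_two, map_add, map_mul, aeval_X, Derivation.leibniz, smul_eq_mul,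
      pderiv_C, mul_zero, add_zero, aeval_C, algebraMap_eq] at hp ⊢
    generalize (aeval fun i => C (g i 0) * X 0 + C (g i 1) * X 1 :
      MvPolynomial (Fin 2) ℝ →ₐ[ℝ] MvPolynomial (Fin 2) ℝ) = φ at hp ⊢
    have h01 := pderiv_X_of_ne (R := ℝ) (zero_ne_one : (0 : Fin 2) ≠ 1)
    have h10 := pderiv_X_of_ne (R := ℝ) (one_ne_zero : (1 : Fin 2) ≠ 0)
    fin_cases i
    · simp only [Fin.zero_eta, pderiv_X_self, h01, h10, map_zero, map_one] at e0 e1 ⊢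
      linear_combination (C (g 0 0) * X 0 + C (g 0 1) * X 1) * hp - φ p * (X 0 * e0 + X 1 * e1)
    · simp only [Fin.mk_one, pderiv_X_self, h01, h10, map_zero, map_one] at e0 e1 ⊢
      linear_combination (C (g 1 0) * X 0 + C (g 1 1) * X 1) * hp - φ p * (X 0 * e0 + X 1 * e1)

theorem exists_coeffs_of_isHomogeneous_five {q : MvPolynomial (Fin 2) ℝ}
    (hq : q.IsHomogeneous 5) :
    ∃ c : ℕ → ℝ, q = ∑ k ∈ Finset.range 6, C (c k) * (X 0 ^ (5 - k) * X 1 ^ k) := by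
  refine ⟨fun k => q.coeff (Finsupp.single 0 (5 - k) + Finsupp.single 1 k), ?_⟩
  have mono (k : ℕ) (a : ℝ) : C a * ((X 0 : MvPolynomial (Fin 2) ℝ) ^ (5 - k) * X 1 ^ k)
      = monomial (Finsupp.single 0 (5 - k) + Finsupp.single 1 k) a := by
    rw [X_pow_eq_monomial, X_pow_eq_monomial, monomial_mul, C_mul_monomial]
    simp
  simp only [mono]
  ext m
  simp only [coeff_sum, coeff_monomial]
  by_cases hm : m.degree = 5
  · have hsum : m 0 + m 1 = 5 := by
      rw [← hm, Finsupp.degree_eq_sum, Fin.sum_univ_two]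
    have hm' : Finsupp.single 0 (5 - m 1) + Finsupp.single 1 (m 1) = m := by
      ext i
      fin_cases i
      · simp; omega
      · simp
    rw [Finset.sum_eq_single (m 1)]
    · rw [hm', if_pos rfl]
    · intro k _ hk
      refine if_neg fun h => hk ?_
      simp [← h]
    · intro h
      simp at h
      omega
  · rw [hq.coeff_eq_zero hm, Finset.sum_eq_zero]
    intro k hk
    refine if_neg fun h => hm ?_
    rw [← h, map_add, Finsupp.degree_single, Finsupp.degree_single]
    have := Finset.mem_range.1 hk
    omega

theorem coeffs_eq_zero_of_forall_eval {a b c d e f : ℝ}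
    (h : ∀ y : ℝ, a + b * y + c * y ^ 2 + d * y ^ 3 + e * y ^ 4 + f * y ^ 5 = 0) :
    a = 0 ∧ b = 0 ∧ c = 0 ∧ d = 0 ∧ e = 0 ∧ f = 0 := by
  have h0 := h 0
  have h1 := h 1
  have h2 := h (-1)
  have h3 := h 2
  have h4 := h (-2)
  have h5 := h 3
  norm_num at h0 h1 h2 h3 h4 h5
  refine ⟨?_, ?_, ?_, ?_, ?_, ?_⟩ <;> linarith

/-- A nonzero quintic eigenvector of `z∂_w + d w∂_z` is a product of linear eigenvectors. -/
theorem eq_of_matDeriv_companion {q : MvPolynomial (Fin 2) ℝ} (hq : q ≠ 0)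
    (hq5 : q.IsHomogeneous 5) {d l : ℝ} (h : matDeriv !![0, 1; d, 0] q = l • q) :
    ∃ c α : ℝ, c ≠ 0 ∧ ∃ n : Fin 3,
      q = C c * ((X 0 + C α * X 1) ^ (5 - n.val) * (X 0 - C α * X 1) ^ n.val) := by
  obtain ⟨c, hc⟩ := exists_coeffs_of_isHomogeneous_five hq5
  simp only [Finset.sum_range_succ, Finset.sum_range_zero, zero_add] at hc
  have hev (y : ℝ) := congrArg (eval ![1, y]) h
  simp only [hc, matDeriv, Fin.sum_univ_two] at hev
  simp [pderiv_X, Derivation.leibniz, Derivation.leibniz_pow] at hev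
  obtain ⟨h0, h1, h2, h3, h4, h5⟩ := coeffs_eq_zero_of_forall_eval
    (a := c 1 - l * c 0) (b := 2 * c 2 + 5 * d * c 0 - l * c 1)
    (c := 3 * c 3 + 4 * d * c 1 - l * c 2) (d := 4 * c 4 + 3 * d * c 2 - l * c 3)
    (e := 5 * c 5 + 2 * d * c 3 - l * c 4) (f := d * c 4 - l * c 5)
    (fun y => by linear_combination hev y)
  have e1 : c 1 = l * c 0 := by linarith
  have e2 : c 2 = (l * c 1 - 5 * d * c 0) / 2 := by linarith
  have e3 : c 3 = (l * c 2 - 4 * d * c 1) / 3 := by linarith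
  have e4 : c 4 = (l * c 3 - 3 * d * c 2) / 4 := by linarith
  have e5 : c 5 = (l * c 4 - 2 * d * c 3) / 5 := by linarith
  rw [e1] at e2
  rw [e1, e2] at e3
  rw [e2, e3] at e4
  rw [e3, e4] at e5
  have hc0 : c 0 ≠ 0 := by
    intro hz
    apply hq
    simp [hc, e1, e2, e3, e4, e5, hz]
  have hchar : (l ^ 2 - d) * (l ^ 2 - 9 * d) * (l ^ 2 - 25 * d) = 0 := by
    apply mul_left_cancel₀ hc0
    rw [e4, e5] at h5
    linear_combination -120 * h5
  rcases mul_eq_zero.1 hchar with hchar | hd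
  · rcases mul_eq_zero.1 hchar with hd | hd
    · obtain rfl : d = l ^ 2 := by linarith
      refine ⟨c 0, l, hc0, 2, ?_⟩
      rw [hc, e1, e2, e3, e4, e5]
      apply MvPolynomial.funext
      intro x
      simp
      ring
    · obtain rfl : d = l ^ 2 / 9 := by linarith
      refine ⟨c 0, l / 3, hc0, 1, ?_⟩
      rw [hc, e1, e2, e3, e4, e5]
      apply MvPolynomial.funext
      intro x
      simp
      ring
  · obtain rfl : d = l ^ 2 / 25 := by linarith
    refine ⟨c 0, l / 5, hc0, 0, ?_⟩
    rw [hc, e1, e2, e3, e4, e5]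
    apply MvPolynomial.funext
    intro x
    simp
    ring

/-- A nonzero traceless matrix has a cyclic vector, hence is similar to a companion matrix. -/
theorem exists_similar_companion {M : Matrix (Fin 2) (Fin 2) ℝ} (hM : M ≠ 0)
    (htr : M.trace = 0) :
    ∃ (g : GL (Fin 2) ℝ) (d : ℝ),
      (g : Matrix (Fin 2) (Fin 2) ℝ) * (!![0, 1; d, 0] : Matrix (Fin 2) (Fin 2) ℝ).transpose
        = M.transpose * g := by
  obtain ⟨a, b, c, e, rfl⟩ : ∃ a b c e : ℝ, M = !![a, b; c, e] :=
    ⟨M 0 0, M 0 1, M 1 0, M 1 1, Matrix.eta_fin_two M⟩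
  obtain rfl : e = -a := by
    simp [Matrix.trace_fin_two] at htr
    linarith
  have key (u v : ℝ) (huv : u * (b * u - a * v) - v * (a * u + c * v) ≠ 0) :
      ∃ (g : GL (Fin 2) ℝ) (d : ℝ),
      (g : Matrix (Fin 2) (Fin 2) ℝ) * (!![0, 1; d, 0] : Matrix (Fin 2) (Fin 2) ℝ).transpose
        = (!![a, b; c, -a] : Matrix (Fin 2) (Fin 2) ℝ).transpose * g := by
    refine ⟨Matrix.GeneralLinearGroup.mkOfDetNeZero !![u, a * u + c * v; v, b * u - a * v]
      (by rw [Matrix.det_fin_two_of]; contrapose! huv; linarith), a ^ 2 + b * c, ?_⟩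
    ext i j
    fin_cases i <;> fin_cases j <;>
      simp [Matrix.GeneralLinearGroup.mkOfDetNeZero, Matrix.mul_apply, Fin.sum_univ_two] <;> ring
  by_cases hb : b = 0
  · by_cases hc : c = 0
    · refine key 1 1 ?_
      intro h
      apply hM
      have ha : a = 0 := by linarith
      ext i j
      fin_cases i <;> fin_cases j <;> simp [ha, hb, hc]
    · exact key 0 1 (by simpa using hc)
  · exact key 1 0 (by simpa using hb)

theorem exists_pow_five_eq (c : ℝ) : ∃ t : ℝ, t ^ 5 = c := by
  have root {x : ℝ} (hx : 0 ≤ x) : (x ^ (5⁻¹ : ℝ)) ^ 5 = x := by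
    simpa using Real.rpow_inv_natCast_pow hx (n := 5) (by norm_num)
  rcases le_total 0 c with hc | hc
  · exact ⟨_, root hc⟩
  · refine ⟨-((-c) ^ (5⁻¹ : ℝ)), ?_⟩
    rw [Odd.neg_pow (by decide), root (neg_nonneg.2 hc), neg_neg]

theorem exists_matSubst_eq_normalForm {c α : ℝ} (hc : c ≠ 0) (n : Fin 3) :
    ∃ (k : GL (Fin 2) ℝ) (m : Fin 3), matSubst k (X 0 ^ (5 - m.val) * X 1 ^ m.val)
      = C c * ((X 0 + C α * X 1) ^ (5 - n.val) * (X 0 - C α * X 1) ^ n.val) := by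
  obtain ⟨t, rfl⟩ := exists_pow_five_eq c
  have ht : t ≠ 0 := by
    rintro rfl
    simp at hc
  by_cases hα : α = 0
  · refine ⟨Matrix.GeneralLinearGroup.mkOfDetNeZero !![t, 0; 0, 1]
      (by simpa [Matrix.det_fin_two_of] using ht), 0, ?_⟩
    fin_cases n <;>
      simp [hα, matSubst, Matrix.GeneralLinearGroup.mkOfDetNeZero] <;> ring
  · refine ⟨Matrix.GeneralLinearGroup.mkOfDetNeZero !![t, t * α; t, -(t * α)]
      (by
        rw [Matrix.det_fin_two_of]
        intro h
        have : t * (t * α) ≠ 0 := by positivity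
        apply this
        linarith), n, ?_⟩
    fin_cases n <;>
      simp [matSubst, Matrix.GeneralLinearGroup.mkOfDetNeZero] <;> ring

theorem exists_matrix_eigen {μ : (ℝ × ℝ) →ₗ[ℝ] ℝ} (hμ : μ ≠ 0) {q : MvPolynomial (Fin 2) ℝ}
    (hq : q ≠ 0)
    (hstab : ∃ P₁ P₂, P₁ ∈ quinticStab μ q ∧ P₂ ∈ quinticStab μ q ∧
      LinearIndependent ℝ ![P₁, P₂]) :
    ∃ (M : Matrix (Fin 2) (Fin 2) ℝ) (l : ℝ), M ≠ 0 ∧ M.trace = 0 ∧ matDeriv M q = l • q := by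
  obtain ⟨⟨M₁, v₁⟩, ⟨M₂, v₂⟩, ⟨tr₁, h₁⟩, ⟨tr₂, h₂⟩, hli⟩ := hstab
  by_cases hM₁ : M₁ = 0
  · by_cases hM₂ : M₂ = 0
    · exfalso
      subst hM₁ hM₂
      have hz₁ : μ v₁ = 0 := by simpa [matDeriv, hq] using h₁
      have hz₂ : μ v₂ = 0 := by simpa [matDeriv, hq] using h₂
      have hμ' (v : ℝ × ℝ) : μ v = v.1 * μ (1, 0) + v.2 * μ (0, 1) := by
        conv_lhs => rw [show v = v.1 • ((1, 0) : ℝ × ℝ) + v.2 • ((0, 1) : ℝ × ℝ) by ext <;> simp]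
        simp only [map_add, map_smul, smul_eq_mul]
      rw [hμ'] at hz₁ hz₂
      have hdet : v₁.1 * v₂.2 - v₁.2 * v₂.1 = 0 := by
        by_contra hne
        apply hμ
        have ha : μ (1, 0) = 0 := by
          apply mul_left_cancel₀ hne
          linear_combination v₂.2 * hz₁ - v₁.2 * hz₂
        have hb : μ (0, 1) = 0 := by
          apply mul_left_cancel₀ hne
          linear_combination v₁.1 * hz₂ - v₂.1 * hz₁
        ext <;> simp [ha, hb]
      rw [LinearIndependent.pair_iff] at hli
      have hs := hli v₂.1 (-v₁.1) (by
        ext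
        · simp
        · simp; ring
        · simp; linarith)
      have ht := hli v₂.2 (-v₁.2) (by
        ext
        · simp
        · simp; linarith
        · simp; ring)
      have hv : v₁ = 0 := by
        ext
        · simpa using hs.2
        · simpa using ht.2
      have := hli 1 0 (by simp [hv])
      simp at this
    · exact ⟨M₂, -μ v₂, hM₂, tr₂, by rw [neg_smul]; exact eq_neg_of_add_eq_zero_left h₂⟩
  · exact ⟨M₁, -μ v₁, hM₁, tr₁, by rw [neg_smul]; exact eq_neg_of_add_eq_zero_left h₁⟩

/-- The orbits of `z ^ (5 - n) * w ^ n` for `n ≤ 2` are pairwise distinct. -/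
theorem not_matSubst_normalForm_of_lt (g : GL (Fin 2) ℝ) {n m : Fin 3} (hnm : n < m) :
    matSubst g (X 0 ^ (5 - n.val) * X 1 ^ n.val) ≠ X 0 ^ (5 - m.val) * X 1 ^ m.val := by
  intro h
  have hdet := g.det_ne_zero
  rw [Matrix.det_fin_two] at hdet
  have hev (x y : ℝ) := congrArg (eval ![x, y]) h
  simp only [matSubst, Fin.sum_univ_two, map_mul, map_pow, aeval_X, map_add, eval_C, eval_X,
    Matrix.cons_val_zero, Matrix.cons_val_one] at hev
  generalize (g : Matrix (Fin 2) (Fin 2) ℝ) 0 0 = a at *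
  generalize (g : Matrix (Fin 2) (Fin 2) ℝ) 0 1 = b at *
  generalize (g : Matrix (Fin 2) (Fin 2) ℝ) 1 0 = c at *
  generalize (g : Matrix (Fin 2) (Fin 2) ℝ) 1 1 = d at *
  have h10 := hev 1 0
  have h01 := hev 0 1
  have h11 := hev 1 1
  have h12 := hev 1 2
  have hm1 := hev (-1) 1
  have h21 := hev 2 1
  fin_cases n <;> fin_cases m <;> simp at hnm
  · simp at h10 h01 h11
    simp [h10, h01] at h11
  · simp at h10 h01 h11
    simp [h10, h01] at h11
  · simp at h10 h01 h11 h12 hm1 h21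
    rcases h10 with rfl | rfl
    · simp at h11 hm1 h21
      rcases h01 with rfl | rfl
      · simp at h11
      · linarith
    · rcases h01 with rfl | rfl
      · simp at h11 h12
        linarith
      · simp at hdet

/-- every nonzero binary quintic whose stabiliser in
`sl(2,ℝ) ⊕ ℝ²` (acting through `sl(2,ℝ)` and by scalars via a nonzero weight
`μ` on the abelian factor) is at least two-dimensional is conjugate under
`GL(2,ℝ)` to exactly one of `z⁵`, `z⁴w`, `z³w²`. -/
theorem quintic_two_dim_stabiliser_classification
    (μ : (ℝ × ℝ) →ₗ[ℝ] ℝ) (hμ : μ ≠ 0)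
    (q : MvPolynomial (Fin 2) ℝ) (hq : q ≠ 0) (hq5 : q.IsHomogeneous 5)
    (hstab : ∃ P₁ P₂, P₁ ∈ quinticStab μ q ∧ P₂ ∈ quinticStab μ q ∧
      LinearIndependent ℝ ![P₁, P₂]) :
    ∃! n : Fin 3, ∃ g : GL (Fin 2) ℝ,
      matSubst (↑g) q
        = ![X 0 ^ 5, X 0 ^ 4 * X 1, X 0 ^ 3 * X 1 ^ 2] n := by
  have hform (n : Fin 3) : (![X 0 ^ 5, X 0 ^ 4 * X 1, X 0 ^ 3 * X 1 ^ 2] n :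
      MvPolynomial (Fin 2) ℝ) = X 0 ^ (5 - n.val) * X 1 ^ n.val := by
    fin_cases n <;> simp
  simp only [hform]
  obtain ⟨M, l, hM, htr, hl⟩ := exists_matrix_eigen hμ hq hstab
  obtain ⟨g, d, hg⟩ := exists_similar_companion hM htr
  have hg0 : matSubst g q ≠ 0 := by
    intro h
    apply hq
    rw [← matSubst_inv_eq h]
    simp [matSubst]
  have heig : matDeriv !![0, 1; d, 0] (matSubst g q) = l • matSubst g q := by
    rw [← matSubst_matDeriv hg, hl]
    simp [matSubst]
  obtain ⟨c, α, hc, n, hn⟩ :=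
    eq_of_matDeriv_companion hg0 (isHomogeneous_matSubst hq5 _) heig
  obtain ⟨k, m, hk⟩ := exists_matSubst_eq_normalForm (α := α) hc n
  have transport {g₁ g₂ : GL (Fin 2) ℝ} {p₁ p₂ : MvPolynomial (Fin 2) ℝ}
      (h₁ : matSubst g₁ q = p₁) (h₂ : matSubst g₂ q = p₂) :
      matSubst (g₁⁻¹ * g₂ : GL (Fin 2) ℝ) p₁ = p₂ := by
    rw [Units.val_mul, matSubst_mul, matSubst_inv_eq h₁, h₂]
  have hm : matSubst (g * k⁻¹ : GL (Fin 2) ℝ) q = X 0 ^ (5 - m.val) * X 1 ^ m.val := by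
    rw [Units.val_mul, matSubst_mul, hn, matSubst_inv_eq hk]
  refine ⟨m, ⟨g * k⁻¹, hm⟩, ?_⟩
  rintro m' ⟨g', hg'⟩
  rcases lt_trichotomy m' m with hlt | heq | hgt
  · exact absurd (transport hg' hm) (not_matSubst_normalForm_of_lt _ hlt)
  · exact heq
  · exact absurd (transport hm hg') (not_matSubst_normalForm_of_lt _ hgt)
end
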